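/- Let a and b be natural numbers with j-th decimal digits a_j := (a / 10^{j−1}) mod 10 and b_j := (b / 10^{j−1}) mod 10, and let c_j := ((a + b) / 10^{j−1}) mod 10 be the j-th decimal digit of a + b. For i ≥ 1 define the rational numbers x_i = Σ_{j=1}^{i} a_j · 10^{j−i}, y_i = Σ_{j=1}^{i} b_j · 10^{j−i}, and z_i = Σ_{j=1}^{i−1} c_j · 10^{j−i}. Then x_i + y_i − z_i is an integer, and 0 ≤ x_i + y_i − z_i ≤ 19. -/

import Mathlib

theorem digit_sum_aux (s n : ℕ) (i : ℤ) :
    (∑ j ∈ Finset.Icc 1 n, ((s / 10 ^ (j - 1) % 10 : ℕ) : ℚ) * (10 : ℚ) ^ ((j : ℤ) - i)) =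
      ((s % 10 ^ n : ℕ) : ℚ) * (10 : ℚ) ^ (1 - i) := by
  induction n with
  | zero => simp [Nat.mod_one]
  | succ n ih =>
    rw [Finset.sum_Icc_succ_top (by omega), ih, Nat.mod_pow_succ]
    have h : (10 : ℚ) ^ (((n + 1 : ℕ) : ℤ) - i) = (10 : ℚ) ^ n * (10 : ℚ) ^ (1 - i) := by
      rw [← zpow_natCast, ← zpow_add₀ (by norm_num)]
      congr 1
      push_cast
      ring
    rw [h, Nat.add_sub_cancel]
    push_cast
    ring

theorem digit_combination_is_bounded_integer (a b i : ℕ) (hi : 1 ≤ i) :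
    ∃ m : ℤ,
      (m : ℚ) =
        (∑ j ∈ Finset.Icc 1 i,
            ((a / 10 ^ (j - 1) % 10 : ℕ) : ℚ) * (10 : ℚ) ^ ((j : ℤ) - (i : ℤ))) +
          (∑ j ∈ Finset.Icc 1 i,
            ((b / 10 ^ (j - 1) % 10 : ℕ) : ℚ) * (10 : ℚ) ^ ((j : ℤ) - (i : ℤ))) -
          (∑ j ∈ Finset.Icc 1 (i - 1),
            (((a + b) / 10 ^ (j - 1) % 10 : ℕ) : ℚ) * (10 : ℚ) ^ ((j : ℤ) - (i : ℤ))) ∧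
      0 ≤ m ∧ m ≤ 19 := by
  obtain ⟨k, rfl⟩ : ∃ k, i = k + 1 := ⟨i - 1, by omega⟩
  rw [digit_sum_aux, digit_sum_aux, digit_sum_aux, Nat.add_sub_cancel]
  have hp : 0 < 10 ^ k := by positivity
  have hA : a % 10 ^ (k + 1) < 10 ^ (k + 1) := Nat.mod_lt _ (by positivity)
  have hB : b % 10 ^ (k + 1) < 10 ^ (k + 1) := Nat.mod_lt _ (by positivity)
  have hC : (a + b) % 10 ^ k = (a % 10 ^ (k + 1) + b % 10 ^ (k + 1)) % 10 ^ k := by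
    have hd : 10 ^ k ∣ 10 ^ (k + 1) := pow_dvd_pow 10 (Nat.le_succ k)
    rw [Nat.add_mod (a % _), Nat.mod_mod_of_dvd _ hd, Nat.mod_mod_of_dvd _ hd, ← Nat.add_mod]
  rw [hC]
  generalize a % 10 ^ (k + 1) = A at *
  generalize b % 10 ^ (k + 1) = B at *
  refine ⟨(((A + B) / 10 ^ k : ℕ) : ℤ), ?_, by positivity, ?_⟩
  · have h : (10 : ℚ) ^ (1 - ((k + 1 : ℕ) : ℤ)) = ((10 : ℚ) ^ k)⁻¹ := by
      rw [← zpow_natCast, ← zpow_neg]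
      congr 1
      push_cast
      ring
    have hm : (((10 ^ k * ((A + B) / 10 ^ k) + (A + B) % 10 ^ k : ℕ)) : ℚ) = ((A + B : ℕ) : ℚ) := by
      rw [Nat.div_add_mod]
    rw [h, Int.cast_natCast]
    generalize (A + B) / 10 ^ k = q at *
    generalize (A + B) % 10 ^ k = r at *
    push_cast at hm
    field_simp
    linarith
  · have : (A + B) / 10 ^ k < 20 := by
      rw [Nat.div_lt_iff_lt_mul hp]
      rw [pow_succ] at hA hB
      omega
    omega
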